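/- arXiv:2410.23324 — 2 statements merged into one kernel-verified Lean document; each statement's English description precedes it below -/
import Mathlib

section
/- The number of domino tilings of the Aztec diamond of order n is 2^(n(n+1)/2). -/
/-- The set of unit squares (indexed by their lower-left corners) making up the Aztec
diamond of order `n`: the square `[i,i+1] × [j,j+1]` lies inside `|x| + |y| ≤ n + 1`
exactly when `|2i+1| + |2j+1| ≤ 2n`. -/
def aztecDiamond (n : ℕ) : Set (ℤ × ℤ) :=
  {p | |2 * p.1 + 1| + |2 * p.2 + 1| ≤ 2 * n}

/-- A domino: a pair of unit squares sharing an edge. -/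
def IsDomino (d : Set (ℤ × ℤ)) : Prop :=
  ∃ p q : ℤ × ℤ, d = {p, q} ∧ |p.1 - q.1| + |p.2 - q.2| = 1

/-- A domino tiling of the Aztec diamond of order `n`: a set of dominoes inside the
region, pairwise disjoint, covering every square. -/
def IsAztecTiling (n : ℕ) (T : Set (Set (ℤ × ℤ))) : Prop :=
  (∀ d ∈ T, IsDomino d ∧ d ⊆ aztecDiamond n) ∧
  (∀ d ∈ T, ∀ d' ∈ T, d ≠ d' → d ∩ d' = ∅) ∧
  (∀ p ∈ aztecDiamond n, ∃ d ∈ T, p ∈ d)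

/-- Offsets, in cyclic order, of the four unit squares around a lattice point. -/
def cornerOffset : Fin 4 → ℤ × ℤ := ![(-1, -1), (0, -1), (0, 0), (-1, 0)]

/-- The `e`-th unit square around the lattice point `c`. -/
def cellSquare (c : ℤ × ℤ) (e : Fin 4) : ℤ × ℤ := c + cornerOffset e

/-- The `k`-th domino contained in the `2 × 2` cell centred at `c`. -/
def cellDomino (c : ℤ × ℤ) (k : Fin 4) : Set (ℤ × ℤ) := {cellSquare c k, cellSquare c (k + 1)}

/-- The centres of the `(n + 1)²` cells that contain every domino of the Aztec diamond of
order `n + 1` exactly once. -/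
noncomputable def cellCenters (n : ℕ) : Finset (ℤ × ℤ) :=
  (Finset.Icc (-(n : ℤ)) n ×ˢ Finset.Icc (-(n : ℤ)) n).filter
    fun c => |c.1| + |c.2| ≤ n ∧ (c.1 + c.2 + n) % 2 = 0

/-- The Aztec diamond as a finite set. -/
noncomputable def aztecFinset (n : ℕ) : Finset (ℤ × ℤ) :=
  (Finset.Icc (-(n : ℤ)) n ×ˢ Finset.Icc (-(n : ℤ)) n).filter
    fun p => |2 * p.1 + 1| + |2 * p.2 + 1| ≤ 2 * n

/-- The squares of a cell covered by a set of its dominoes. -/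
def coveredCorners (m : Finset (Fin 4)) : Finset (Fin 4) :=
  Finset.univ.filter fun e => ∃ k ∈ m, e = k ∨ e = k + 1

/-- The pairwise disjoint sets of dominoes of a cell covering exactly the corners `x`. -/
def cellMatchings (x : Finset (Fin 4)) : Finset (Finset (Fin 4)) :=
  Finset.univ.filter fun m => (∀ k ∈ m, k + 1 ∉ m) ∧ coveredCorners m = x

/-- The dominoes chosen by a family of sets of dominoes of the cells. -/
def cellTiling {n : ℕ} (t : cellCenters n → Finset (Fin 4)) : Set (Set (ℤ × ℤ)) :=
  {d | ∃ c : cellCenters n, ∃ k ∈ t c, d = cellDomino c k}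

/-- Each square of `R` is assigned to exactly one of the cells containing it. -/
def IsOccupancy {n : ℕ} (R : Set (ℤ × ℤ)) (s : cellCenters n → Finset (Fin 4)) : Prop :=
  Set.BijOn (fun x : cellCenters n × Fin 4 => cellSquare x.1 x.2) {x | x.2 ∈ s x.1} R

theorem mem_cellCenters {n : ℕ} {c : ℤ × ℤ} :
    c ∈ cellCenters n ↔ |c.1| + |c.2| ≤ n ∧ (c.1 + c.2 + n) % 2 = 0 := by
  simp only [cellCenters, Finset.mem_filter, Finset.mem_product, Finset.mem_Icc]
  constructor
  · exact fun h => h.2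
  · intro h
    refine ⟨?_, h⟩
    grind

theorem mem_aztecDiamond {n : ℕ} {p : ℤ × ℤ} :
    p ∈ aztecDiamond n ↔ |2 * p.1 + 1| + |2 * p.2 + 1| ≤ 2 * n :=
  Iff.rfl

theorem coe_aztecFinset (n : ℕ) : (aztecFinset n : Set (ℤ × ℤ)) = aztecDiamond n := by
  ext p
  simp only [aztecFinset, aztecDiamond, Finset.coe_filter, Finset.mem_product, Finset.mem_Icc,
    Set.mem_ofPred_eq]
  constructor
  · exact fun h => h.2
  · intro h
    refine ⟨?_, h⟩
    grind

theorem mem_aztecFinset {n : ℕ} {p : ℤ × ℤ} :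
    p ∈ aztecFinset n ↔ |2 * p.1 + 1| + |2 * p.2 + 1| ≤ 2 * n := by
  rw [← Finset.mem_coe, coe_aztecFinset, mem_aztecDiamond]

theorem cellSquare_injective (c : ℤ × ℤ) : Function.Injective (cellSquare c) := by
  have h : Function.Injective cornerOffset := by decide
  exact fun e e' hee => h (add_left_cancel hee)

theorem isDomino_cellDomino (c : ℤ × ℤ) (k : Fin 4) : IsDomino (cellDomino c k) := by
  refine ⟨_, _, rfl, ?_⟩
  fin_cases k <;> simp [cellSquare, cornerOffset]

theorem mem_cellDomino {c p : ℤ × ℤ} {k : Fin 4} :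
    p ∈ cellDomino c k ↔ ∃ e, (e = k ∨ e = k + 1) ∧ cellSquare c e = p := by
  simp only [cellDomino, Set.mem_insert_iff, Set.mem_singleton_iff]
  grind

theorem cellDomino_inj {n : ℕ} {c c' : ℤ × ℤ} (hc : c ∈ cellCenters n) (hc' : c' ∈ cellCenters n)
    {k k' : Fin 4} (h : cellDomino c k = cellDomino c' k') : c = c' ∧ k = k' := by
  have hp := (mem_cellCenters.1 hc).2
  have hp' := (mem_cellCenters.1 hc').2
  obtain ⟨a, b⟩ := c
  obtain ⟨a', b'⟩ := c'
  rw [cellDomino, cellDomino, Set.pair_eq_pair_iff] at h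
  fin_cases k <;> fin_cases k' <;>
    simp [cellSquare, cornerOffset] at h hp hp' ⊢ <;> omega

theorem abs_add_abs_le_iff {a b m : ℤ} :
    |a| + |b| ≤ m ↔ a + b ≤ m ∧ a - b ≤ m ∧ -a + b ≤ m ∧ -a - b ≤ m := by
  grind

theorem exists_cellDomino_eq_horizontal {n : ℕ} {i j : ℤ}
    (hl : |2 * i + 1| + |2 * j + 1| ≤ 2 * n + 2)
    (hr : |2 * (i + 1) + 1| + |2 * j + 1| ≤ 2 * n + 2) :
    ∃ c : cellCenters n, ∃ k, {(i, j), (i + 1, j)} = cellDomino c k := by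
  rw [abs_add_abs_le_iff] at hl hr
  rcases Int.emod_two_eq_zero_or_one (i + j + n) with h | h
  · refine ⟨⟨(i + 1, j + 1), mem_cellCenters.2 ⟨abs_add_abs_le_iff.2 ?_, ?_⟩⟩, 0, ?_⟩
    · omega
    · dsimp only; omega
    · simp [cellDomino, cellSquare, cornerOffset]
  · refine ⟨⟨(i + 1, j), mem_cellCenters.2 ⟨abs_add_abs_le_iff.2 ?_, ?_⟩⟩, 2, ?_⟩
    · omega
    · dsimp only; omega
    · rw [Set.pair_comm]
      simp [cellDomino, cellSquare, cornerOffset]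

theorem exists_cellDomino_eq_vertical {n : ℕ} {i j : ℤ}
    (hl : |2 * i + 1| + |2 * j + 1| ≤ 2 * n + 2)
    (hr : |2 * i + 1| + |2 * (j + 1) + 1| ≤ 2 * n + 2) :
    ∃ c : cellCenters n, ∃ k, {(i, j), (i, j + 1)} = cellDomino c k := by
  rw [abs_add_abs_le_iff] at hl hr
  rcases Int.emod_two_eq_zero_or_one (i + j + n) with h | h
  · refine ⟨⟨(i + 1, j + 1), mem_cellCenters.2 ⟨abs_add_abs_le_iff.2 ?_, ?_⟩⟩, 3, ?_⟩
    · omega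
    · dsimp only; omega
    · rw [Set.pair_comm]
      simp [cellDomino, cellSquare, cornerOffset]
  · refine ⟨⟨(i, j + 1), mem_cellCenters.2 ⟨abs_add_abs_le_iff.2 ?_, ?_⟩⟩, 1, ?_⟩
    · omega
    · dsimp only; omega
    · simp [cellDomino, cellSquare, cornerOffset]

theorem exists_cellDomino_eq {n : ℕ} {d : Set (ℤ × ℤ)} (hd : IsDomino d)
    (hs : d ⊆ aztecDiamond (n + 1)) : ∃ c : cellCenters n, ∃ k, d = cellDomino c k := by
  obtain ⟨⟨i, j⟩, ⟨i', j'⟩, rfl, h⟩ := hd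
  have h1 : (i, j) ∈ aztecDiamond (n + 1) := hs (Set.mem_insert _ _)
  have h2 : (i', j') ∈ aztecDiamond (n + 1) := hs (Set.mem_insert_of_mem _ (Set.mem_singleton _))
  rw [mem_aztecDiamond, Nat.cast_succ, mul_add, mul_one] at h1 h2
  have hcases : (i' = i + 1 ∧ j' = j) ∨ (i = i' + 1 ∧ j' = j) ∨ (i' = i ∧ j' = j + 1) ∨
      (i' = i ∧ j = j' + 1) := by
    have hne : ¬(i = i' ∧ j = j') := by
      rintro ⟨rfl, rfl⟩
      simp at h
    have hle := abs_add_abs_le_iff.1 h.le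
    dsimp only at hle
    omega
  rcases hcases with ⟨rfl, rfl⟩ | ⟨rfl, rfl⟩ | ⟨rfl, rfl⟩ | ⟨rfl, rfl⟩
  · exact exists_cellDomino_eq_horizontal h1 h2
  · rw [Set.pair_comm]
    exact exists_cellDomino_eq_horizontal h2 h1
  · exact exists_cellDomino_eq_vertical h1 h2
  · rw [Set.pair_comm]
    exact exists_cellDomino_eq_vertical h2 h1

theorem isAztecTiling_cellTiling_iff {n m : ℕ} (t : cellCenters n → Finset (Fin 4)) :
    IsAztecTiling m (cellTiling t) ↔
      (∀ c, ∀ k ∈ t c, k + 1 ∉ t c) ∧ IsOccupancy (aztecDiamond m) (coveredCorners ∘ t) := by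
  have hcov : ∀ c e, e ∈ coveredCorners (t c) ↔ ∃ k ∈ t c, e = k ∨ e = k + 1 := by
    simp [coveredCorners]
  constructor
  · rintro ⟨hsub, hdisj, hcover⟩
    have key : ∀ c k c' k' p, k ∈ t c → k' ∈ t c' → p ∈ cellDomino c k →
        p ∈ cellDomino c' k' → c = c' ∧ k = k' := by
      intro c k c' k' p hk hk' hp hp'
      have : cellDomino c k = cellDomino c' k' := by
        by_contra hne
        have h := hdisj _ ⟨c, k, hk, rfl⟩ _ ⟨c', k', hk', rfl⟩ hne
        exact (h ▸ ⟨hp, hp'⟩ : p ∈ (∅ : Set (ℤ × ℤ)))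
      have := cellDomino_inj c.2 c'.2 this
      exact ⟨Subtype.ext this.1, this.2⟩
    refine ⟨fun c k hk hk' => ?_, ?_, ?_, ?_⟩
    · have := (key c k c (k + 1) (cellSquare c (k + 1)) hk hk' (by simp [cellDomino])
        (by simp [cellDomino])).2
      exact absurd this (by clear * -; revert k; decide)
    · rintro ⟨c, e⟩ he
      obtain ⟨k, hk, hek⟩ := (hcov c e).1 he
      exact (hsub _ ⟨c, k, hk, rfl⟩).2 (mem_cellDomino.2 ⟨e, hek, rfl⟩)
    · rintro ⟨c, e⟩ he ⟨c', e'⟩ he' hee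
      obtain ⟨k, hk, hek⟩ := (hcov c e).1 he
      obtain ⟨k', hk', hek'⟩ := (hcov c' e').1 he'
      obtain ⟨rfl, rfl⟩ := key c k c' k' _ hk hk' (mem_cellDomino.2 ⟨e, hek, rfl⟩)
        (mem_cellDomino.2 ⟨e', hek', hee.symm⟩)
      exact congrArg (Prod.mk c) (cellSquare_injective _ hee)
    · intro p hp
      obtain ⟨d, ⟨c, k, hk, rfl⟩, hpd⟩ := hcover p hp
      obtain ⟨e, he, rfl⟩ := mem_cellDomino.1 hpd
      exact ⟨(c, e), (hcov c e).2 ⟨k, hk, he⟩, rfl⟩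
  · rintro ⟨hmatch, hmaps, hinj, hsurj⟩
    refine ⟨?_, ?_, ?_⟩
    · rintro d ⟨c, k, hk, rfl⟩
      refine ⟨isDomino_cellDomino _ _, fun p hp => ?_⟩
      obtain ⟨e, he, rfl⟩ := mem_cellDomino.1 hp
      exact hmaps (x := (c, e)) ((hcov c e).2 ⟨k, hk, he⟩)
    · rintro d ⟨c, k, hk, rfl⟩ d' ⟨c', k', hk', rfl⟩ hne
      by_contra hinter
      obtain ⟨p, hp, hp'⟩ := Set.nonempty_iff_ne_empty.2 hinter
      obtain ⟨e, he, rfl⟩ := mem_cellDomino.1 hp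
      obtain ⟨e', he', hee⟩ := mem_cellDomino.1 hp'
      have := @hinj (c, e) ((hcov c e).2 ⟨k, hk, he⟩) (c', e') ((hcov c' e').2 ⟨k', hk', he'⟩)
        hee.symm
      obtain ⟨rfl, rfl⟩ := Prod.mk.inj this
      have h1 := hmatch c k hk
      have h2 := hmatch c k' hk'
      grind
    · intro p hp
      obtain ⟨⟨c, e⟩, he, rfl⟩ := hsurj hp
      obtain ⟨k, hk, hek⟩ := (hcov c e).1 he
      exact ⟨_, ⟨c, k, hk, rfl⟩, mem_cellDomino.2 ⟨e, hek, rfl⟩⟩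

theorem mem_cellTiling_iff {n : ℕ} (t : cellCenters n → Finset (Fin 4)) (c : cellCenters n)
    (k : Fin 4) : cellDomino c k ∈ cellTiling t ↔ k ∈ t c := by
  constructor
  · rintro ⟨c', k', hk', h⟩
    obtain ⟨hc, rfl⟩ := cellDomino_inj c.2 c'.2 h
    rwa [Subtype.ext hc]
  · exact fun hk => ⟨c, k, hk, rfl⟩

theorem aztecDiamond_mono : Monotone aztecDiamond := by
  intro m n h p hp
  have : (m : ℤ) ≤ n := by exact_mod_cast h
  rw [mem_aztecDiamond] at hp ⊢
  omega

open Classical in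
theorem card_isAztecTiling_eq_card_cellTiling {n m : ℕ} (hm : m ≤ n + 1) :
    Nat.card {T : Set (Set (ℤ × ℤ)) // IsAztecTiling m T} =
      (Finset.univ.filter fun t : cellCenters n → Finset (Fin 4) =>
        IsAztecTiling m (cellTiling t)).card := by
  rw [← Fintype.card_subtype, ← Nat.card_eq_fintype_card]
  refine (Nat.card_eq_of_bijective (fun t => ⟨cellTiling t.1, t.2⟩) ⟨?_, ?_⟩).symm
  · rintro ⟨t, ht⟩ ⟨t', ht'⟩ h
    simp only [Subtype.mk.injEq] at h ⊢
    ext c k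
    rw [← mem_cellTiling_iff, h, mem_cellTiling_iff]
  · rintro ⟨T, hT⟩
    have h : cellTiling (fun c : cellCenters n =>
        Finset.univ.filter fun k => cellDomino c k ∈ T) = T := by
      ext d
      constructor
      · rintro ⟨c, k, hk, rfl⟩
        simpa using hk
      · intro hd
        obtain ⟨c, k, rfl⟩ := exists_cellDomino_eq (n := n) (hT.1 d hd).1
          ((hT.1 d hd).2.trans (aztecDiamond_mono hm))
        exact ⟨c, k, by simpa using hd, rfl⟩
    exact ⟨⟨_, h.symm ▸ hT⟩, Subtype.ext h⟩

open Classical in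
theorem card_isAztecTiling_eq_sum {n m : ℕ} (hm : m ≤ n + 1) :
    Nat.card {T : Set (Set (ℤ × ℤ)) // IsAztecTiling m T} =
      ∑ s : cellCenters n → Finset (Fin 4) with IsOccupancy (aztecDiamond m) s,
        ∏ c, (cellMatchings (s c)).card := by
  rw [card_isAztecTiling_eq_card_cellTiling hm,
    Finset.card_eq_sum_card_fiberwise (f := fun t => coveredCorners ∘ t)
      (t := Finset.univ.filter fun s : cellCenters n → Finset (Fin 4) =>
        IsOccupancy (aztecDiamond m) s)]
  · refine Finset.sum_congr rfl fun s hs => ?_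
    rw [← Fintype.card_piFinset]
    congr 1
    ext t
    simp only [Finset.mem_filter, Finset.mem_univ, true_and, isAztecTiling_cellTiling_iff,
      Fintype.mem_piFinset, cellMatchings] at hs ⊢
    constructor
    · rintro ⟨⟨h1, -⟩, rfl⟩ c
      exact ⟨h1 c, rfl⟩
    · intro h
      have : coveredCorners ∘ t = s := funext fun c => (h c).2
      exact ⟨⟨fun c => (h c).1, this ▸ hs⟩, this⟩
  · intro t ht
    simpa using ((isAztecTiling_cellTiling_iff t).1 (by simpa using ht)).2

theorem card_cellSquare_fiber (n : ℕ) (p : ℤ × ℤ) :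
    (Finset.univ.filter fun x : cellCenters n × Fin 4 => cellSquare x.1 x.2 = p).card =
      (if p ∈ aztecFinset (n + 1) then 1 else 0) + if p ∈ aztecFinset n then 1 else 0 := by
  have h : ∀ e, (∑ c : cellCenters n, if cellSquare c e = p then 1 else 0) =
      if p - cornerOffset e ∈ cellCenters n then 1 else 0 := by
    intro e
    rw [Finset.sum_coe_sort (cellCenters n) fun c => if cellSquare c e = p then 1 else 0]
    simp only [cellSquare, ← eq_sub_iff_add_eq, Finset.sum_ite_eq']
  rw [Finset.card_filter, Fintype.sum_prod_type_right]
  simp only [h, Fin.sum_univ_four]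
  obtain ⟨i, j⟩ := p
  simp only [mem_cellCenters, mem_aztecFinset, cornerOffset]
  simp [abs_add_abs_le_iff]
  split_ifs <;> omega

open Classical in
theorem isOccupancy_iff_card {n : ℕ} (R : Set (ℤ × ℤ)) (s : cellCenters n → Finset (Fin 4)) :
    IsOccupancy R s ↔ ∀ p, (Finset.univ.filter fun x : cellCenters n × Fin 4 =>
      x.2 ∈ s x.1 ∧ cellSquare x.1 x.2 = p).card = if p ∈ R then 1 else 0 := by
  constructor
  · rintro ⟨hmaps, hinj, hsurj⟩ p
    split_ifs with hp
    · obtain ⟨x, hx, rfl⟩ := hsurj hp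
      refine Finset.card_eq_one.2 ⟨x, ?_⟩
      ext y
      simp only [Finset.mem_filter, Finset.mem_univ, true_and, Finset.mem_singleton]
      constructor
      · exact fun h => hinj h.1 hx h.2
      · rintro rfl
        exact ⟨hx, rfl⟩
    · simp only [Finset.card_eq_zero, Finset.filter_eq_empty_iff, Finset.mem_univ, true_implies]
      rintro x ⟨hx, rfl⟩
      exact hp (hmaps hx)
  · intro h
    refine ⟨fun x hx => ?_, fun x hx y hy hxy => ?_, fun p hp => ?_⟩
    · by_contra hp
      have h0 := h (cellSquare x.1 x.2)
      rw [if_neg hp, Finset.card_eq_zero, Finset.filter_eq_empty_iff] at h0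
      exact h0 (Finset.mem_univ x) ⟨hx, rfl⟩
    · have h1 := h (cellSquare x.1 x.2)
      exact Finset.card_le_one.1 (h1.le.trans (by split_ifs <;> simp)) x (by simpa using hx) y
        (by simpa using ⟨hy, hxy.symm⟩)
    · have h1 := h p
      rw [if_pos hp] at h1
      obtain ⟨x, hx⟩ := Finset.card_pos.1 (h1 ▸ Nat.one_pos)
      simp only [Finset.mem_filter, Finset.mem_univ, true_and] at hx
      exact ⟨x, hx⟩

theorem isOccupancy_compl_iff {n : ℕ} (s : cellCenters n → Finset (Fin 4)) :
    IsOccupancy (aztecDiamond n) sᶜ ↔ IsOccupancy (aztecDiamond (n + 1)) s := by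
  classical
  simp only [isOccupancy_iff_card, ← coe_aztecFinset, Finset.mem_coe]
  refine forall_congr' fun p => ?_
  have h := card_cellSquare_fiber n p
  rw [← Finset.card_filter_add_card_filter_not (fun x => x.2 ∈ s x.1), Finset.filter_filter,
    Finset.filter_filter] at h
  simp only [and_comm (a := cellSquare _ _ = p)] at h
  simp only [Pi.compl_apply, Finset.mem_compl]
  omega

theorem card_cellCenters (n : ℕ) : (cellCenters n).card = (n + 1) ^ 2 := by
  have : (Finset.range (n + 1) ×ˢ Finset.range (n + 1)).card = (cellCenters n).card := by
    refine Finset.card_nbij' (fun x => ((x.1 : ℤ) + x.2 - n, (x.1 : ℤ) - x.2))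
      (fun c => (((c.1 + c.2 + n) / 2).toNat, ((c.1 - c.2 + n) / 2).toNat)) ?_ ?_ ?_ ?_
    · rintro ⟨x, y⟩ h
      simp only [Finset.coe_product, Finset.coe_range, Set.mem_prod, Set.mem_Iio,
        Finset.mem_coe, mem_cellCenters] at h ⊢
      grind
    · rintro ⟨a, b⟩ h
      simp only [Finset.coe_product, Finset.coe_range, Set.mem_prod, Set.mem_Iio,
        Finset.mem_coe, mem_cellCenters] at h ⊢
      grind
    · rintro ⟨x, y⟩ h
      simp only [Prod.mk.injEq]
      omega
    · rintro ⟨a, b⟩ h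
      simp only [Finset.mem_coe, mem_cellCenters] at h
      simp only [Prod.mk.injEq]
      grind
  rw [← this, Finset.card_product, Finset.card_range, sq]

theorem aztecFinset_zero : aztecFinset 0 = ∅ := by
  ext p
  simp only [mem_aztecFinset, Finset.notMem_empty, iff_false]
  grind

theorem card_aztecFinset (n : ℕ) : (aztecFinset n).card = 2 * n * (n + 1) := by
  induction n with
  | zero => simp [aztecFinset_zero]
  | succ n ih =>
    have hsub : aztecFinset n ⊆ aztecFinset (n + 1) := by
      rw [← Finset.coe_subset, coe_aztecFinset, coe_aztecFinset]
      exact aztecDiamond_mono n.le_succ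
    have h := Finset.card_eq_sum_card_fiberwise (s := Finset.univ) (t := aztecFinset (n + 1))
      (f := fun x : cellCenters n × Fin 4 => cellSquare x.1 x.2) (by
        intro x _
        by_contra hx
        have hx' : cellSquare x.1 x.2 ∉ aztecFinset (n + 1) := hx
        have h0 := card_cellSquare_fiber n (cellSquare x.1 x.2)
        rw [if_neg hx', if_neg fun h => hx' (hsub h), Finset.card_eq_zero,
          Finset.filter_eq_empty_iff] at h0
        exact h0 (Finset.mem_univ x) rfl)
    simp only [card_cellSquare_fiber, Finset.sum_add_distrib, ← Finset.card_filter,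
      Finset.filter_mem_eq_inter, Finset.inter_self, Finset.inter_eq_right.2 hsub, ih,
      Finset.card_univ, Fintype.card_prod, Fintype.card_coe, card_cellCenters,
      Fintype.card_fin] at h
    linarith

theorem sq_card_cellMatchings (x : Finset (Fin 4)) :
    4 * (cellMatchings x).card ^ 2 = 2 ^ x.card * (cellMatchings xᶜ).card ^ 2 := by
  revert x
  decide

theorem IsOccupancy.sum_card {n m : ℕ} {s : cellCenters n → Finset (Fin 4)}
    (hs : IsOccupancy (aztecDiamond m) s) : ∑ c, (s c).card = (aztecFinset m).card := by
  rw [← Finset.card_sigma]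
  refine Finset.card_nbij (fun x => cellSquare x.1 x.2) ?_ ?_ ?_
  · intro x hx
    rw [coe_aztecFinset]
    exact hs.mapsTo (x := (x.1, x.2)) (by simpa using hx)
  · rintro ⟨c, e⟩ hx ⟨c', e'⟩ hy hxy
    have := hs.injOn (x₁ := (c, e)) (by simpa using hx) (x₂ := (c', e')) (by simpa using hy) hxy
    obtain ⟨rfl, rfl⟩ := Prod.mk.inj this
    rfl
  · intro p hp
    rw [coe_aztecFinset] at hp
    obtain ⟨x, hx, rfl⟩ := hs.surjOn hp
    exact ⟨⟨x.1, x.2⟩, by simpa using hx, rfl⟩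

theorem IsOccupancy.prod_card_cellMatchings {n : ℕ} {s : cellCenters n → Finset (Fin 4)}
    (hs : IsOccupancy (aztecDiamond (n + 1)) s) :
    ∏ c, (cellMatchings (s c)).card = 2 ^ (n + 1) * ∏ c, (cellMatchings (sᶜ c)).card := by
  have h : ∏ c, (4 * (cellMatchings (s c)).card ^ 2) =
      ∏ c, (2 ^ (s c).card * (cellMatchings (sᶜ c)).card ^ 2) :=
    Finset.prod_congr rfl fun c _ => sq_card_cellMatchings (s c)
  rw [Finset.prod_mul_distrib, Finset.prod_mul_distrib, Finset.prod_pow, Finset.prod_pow,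
    Finset.prod_pow_eq_pow_sum, hs.sum_card, card_aztecFinset, Finset.prod_const,
    Finset.card_univ, Fintype.card_coe, card_cellCenters] at h
  have h2 : 2 ^ (2 * (n + 1) * (n + 1 + 1)) = 4 ^ ((n + 1) ^ 2) * (2 ^ (n + 1)) ^ 2 := by
    rw [show 4 = 2 ^ 2 from rfl, ← pow_mul, ← pow_mul, ← pow_add]
    congr 1
    ring
  rw [h2, mul_assoc, ← mul_pow] at h
  exact Nat.pow_left_injective two_ne_zero (Nat.eq_of_mul_eq_mul_left (by positivity) h)

theorem card_isAztecTiling_succ (n : ℕ) :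
    Nat.card {T : Set (Set (ℤ × ℤ)) // IsAztecTiling (n + 1) T} =
      2 ^ (n + 1) * Nat.card {T : Set (Set (ℤ × ℤ)) // IsAztecTiling n T} := by
  classical
  rw [card_isAztecTiling_eq_sum le_rfl, card_isAztecTiling_eq_sum n.le_succ, Finset.mul_sum]
  refine Finset.sum_nbij' compl compl ?_ ?_ ?_ ?_ ?_
  · intro s hs
    simpa [isOccupancy_compl_iff] using hs
  · intro s hs
    simpa [← isOccupancy_compl_iff] using hs
  · simp
  · simp
  · intro s hs
    exact (Finset.mem_filter.1 hs).2.prod_card_cellMatchings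

theorem isAztecTiling_zero_iff (T : Set (Set (ℤ × ℤ))) : IsAztecTiling 0 T ↔ T = ∅ := by
  have h0 : aztecDiamond 0 = ∅ := by rw [← coe_aztecFinset, aztecFinset_zero, Finset.coe_empty]
  constructor
  · rintro ⟨h, -, -⟩
    refine Set.eq_empty_of_forall_notMem fun d hd => ?_
    obtain ⟨⟨p, q, rfl, -⟩, hsub⟩ := h d hd
    exact (h0 ▸ hsub (Set.mem_insert p _) : p ∈ (∅ : Set (ℤ × ℤ)))
  · rintro rfl
    simp [IsAztecTiling, h0]

/-- Aztec Diamond Theorem: the number of domino tilings of the Aztec diamond of order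
`n` is `2^(n(n+1)/2)`. -/
theorem aztec_diamond_theorem (n : ℕ) :
    Nat.card {T : Set (Set (ℤ × ℤ)) // IsAztecTiling n T} = 2 ^ (n * (n + 1) / 2) := by
  induction n with
  | zero => simp [isAztecTiling_zero_iff]
  | succ n ih =>
    rw [card_isAztecTiling_succ, ih, ← pow_add]
    congr 1
    rw [show (n + 1) * (n + 1 + 1) = n * (n + 1) + (n + 1) * 2 by ring,
      Nat.add_mul_div_right _ _ two_pos, add_comm]
end

section
/- The l² norm of C_n equals 2^{n(n+1)/2}, i.e., Σ_{ε ∈ {0,1}^{2n}} C_n(ε)² = 2^{n(n+1)/2}. -/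
/-! Binary sequences are encoded as `List Bool` (`false = 0`, `true = 1`); the free
abelian group on binary sequences is `List Bool →₀ ℤ`. -/

/-- Extend a map on binary sequences ℤ-linearly to the free abelian group. -/
noncomputable def extendZ (f : List Bool → (List Bool →₀ ℤ)) :
    (List Bool →₀ ℤ) →+ (List Bool →₀ ℤ) :=
  Finsupp.liftAddHom fun l => zmultiplesHom _ (f l)

/-- Extend a ℤ-valued function on binary sequences ℤ-linearly. -/
noncomputable def liftZ (f : List Bool → ℤ) : (List Bool →₀ ℤ) →+ ℤ :=
  Finsupp.liftAddHom fun l => zmultiplesHom _ (f l)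

/-- The reverse map `R`: complement every bit. -/
noncomputable def Rhom : (List Bool →₀ ℤ) →+ (List Bool →₀ ℤ) :=
  extendZ fun l => Finsupp.single (l.map (fun b => !b)) 1

/-- The basic expansion at (0-based) position `i`: a sequence with bits `(0,0)` in
positions `(i, i+1)` is sent to the sum of itself and the sequence with those bits
replaced by `(1,1)`; all other sequences are fixed. -/
noncomputable def basicExp (i : ℕ) (l : List Bool) : List Bool →₀ ℤ :=
  if l.getD i true = false ∧ l.getD (i + 1) true = false then
    Finsupp.single l 1 + Finsupp.single ((l.set i true).set (i + 1) true) 1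
  else Finsupp.single l 1

/-- `EhomAux j` is the composite of the basic expansions at positions `0, …, j-1`
(position `0` applied first). `EhomAux (m-1)` is the expansion map `E_m`. -/
noncomputable def EhomAux : ℕ → ((List Bool →₀ ℤ) →+ (List Bool →₀ ℤ))
  | 0 => AddMonoidHom.id _
  | (j + 1) => (extendZ (basicExp j)).comp (EhomAux j)

/-- Contraction of the first two bits: `(0,0) ↦ 1`, `(1,1) ↦ 1`, `(1,0) ↦ 0`,
and `(0,1)` kills the generator. -/
def contractFront : Bool → Bool → Option Bool
  | false, false => some true
  | true, true => some true
  | true, false => some false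
  | false, true => none

/-- Contraction of the last two bits: `(0,0) ↦ 1`, `(1,1) ↦ 1`, `(0,1) ↦ 0`,
and `(1,0)` kills the generator. -/
def contractBack : Bool → Bool → Option Bool
  | false, false => some true
  | true, true => some true
  | false, true => some false
  | true, false => none

/-- The contraction map `K` on generators. -/
noncomputable def Kfun (l : List Bool) : List Bool →₀ ℤ :=
  match l, l.reverse with
  | a :: b :: _, c :: d :: _ =>
    match contractFront a b, contractBack d c with
    | some x, some z => Finsupp.single (x :: (((l.drop 2).dropLast.dropLast) ++ [z])) 1
    | _, _ => 0
  | _, _ => 0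

/-- The contraction map `K`, extended ℤ-linearly. -/
noncomputable def Khom : (List Bool →₀ ℤ) →+ (List Bool →₀ ℤ) := extendZ Kfun

/-- The base function `C_1`: value `1` on `(0,0)` and `(1,1)`, `0` otherwise. -/
def C1fun (l : List Bool) : ℤ :=
  if l = [false, false] ∨ l = [true, true] then 1 else 0

/-- `Chom n` is the function `C_n` viewed as a homomorphism from the free abelian group
on binary sequences to `ℤ`, defined by `C_1` as above and the inductive formula
`C_n = C_{n-1} ∘ R_{2n-2} ∘ E_{2n-2} ∘ K_{2n}` (here `EhomAux (2n-3)` is `E_{2n-2}`). -/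
noncomputable def Chom : ℕ → ((List Bool →₀ ℤ) →+ ℤ)
  | 0 => liftZ C1fun
  | 1 => liftZ C1fun
  | (n + 2) => (((Chom (n + 1)).comp Rhom).comp (EhomAux (2 * n + 1))).comp Khom

/-- The function `C_n : {0,1}^{2n} → ℤ`. -/
noncomputable def Cfun (n : ℕ) (ε : Fin (2 * n) → Bool) : ℤ :=
  Chom n (Finsupp.single (List.ofFn ε) 1)

open ExteriorAlgebra in
/-- The top coefficient on `⋀ ℤⁿ`: the determinant in degree `n`, zero in other degrees. -/
noncomputable def topCoeff (n : ℕ) : ExteriorAlgebra ℤ (Fin n → ℤ) →ₗ[ℤ] ℤ :=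
  liftAlternating fun i =>
    if h : i = n then Matrix.detRowAlternating.domDomCongr (finCongr h.symm) else 0

namespace ExteriorAlgebra

/-- A functional on the exterior algebra that vanishes outside degree `d`. -/
def IsHomogeneousFunctional {n : ℕ} (d : ℕ) (X : ExteriorAlgebra ℤ (Fin n → ℤ) →ₗ[ℤ] ℤ) : Prop :=
  ∀ i, i ≠ d → ∀ w : Fin i → Fin n → ℤ, X (ιMulti ℤ i w) = 0

lemma linearMap_ext {M N : Type*} [AddCommGroup M] [AddCommGroup N]
    {X Y : ExteriorAlgebra ℤ M →ₗ[ℤ] N}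
    (h : ∀ i (w : Fin i → M), X (ιMulti ℤ i w) = Y (ιMulti ℤ i w)) : X = Y :=
  lhom_ext fun i => AlternatingMap.ext (h i)

lemma ι_mul_ιMulti {M : Type*} [AddCommGroup M] {i : ℕ} (a : M) (w : Fin i → M) :
    ι ℤ a * ιMulti ℤ i w = ιMulti ℤ (i + 1) (Fin.cons a w) := by
  rw [ιMulti_succ_apply]
  rfl

end ExteriorAlgebra

open ExteriorAlgebra

lemma topCoeff_ιMulti {n : ℕ} (w : Fin n → Fin n → ℤ) :
    topCoeff n (ιMulti ℤ n w) = Matrix.det (Matrix.of w) := by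
  simp only [topCoeff, liftAlternating_apply_ιMulti, dite_true]
  rfl

lemma isHomogeneousFunctional_topCoeff (n : ℕ) : IsHomogeneousFunctional n (topCoeff n) := by
  intro i hi w
  simp [topCoeff, hi]

lemma topCoeff_map {n : ℕ} (L : Matrix (Fin n) (Fin n) ℤ) (x : ExteriorAlgebra ℤ (Fin n → ℤ)) :
    topCoeff n (map L.toLin' x) = L.det * topCoeff n x := by
  suffices h : topCoeff n ∘ₗ (map L.toLin').toLinearMap = L.det • topCoeff n from
    LinearMap.congr_fun h x
  refine linearMap_ext fun i w => ?_
  simp only [LinearMap.comp_apply, AlgHom.toLinearMap_apply, map_apply_ιMulti,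
    LinearMap.smul_apply, smul_eq_mul]
  rcases eq_or_ne i n with rfl | hi
  · rw [topCoeff_ιMulti, topCoeff_ιMulti, ← Matrix.det_transpose L, mul_comm, ← Matrix.det_mul]
    congr 1
    ext a b
    simp [Matrix.mul_apply, Matrix.mulVec, dotProduct, mul_comm]
  · rw [isHomogeneousFunctional_topCoeff n i hi, isHomogeneousFunctional_topCoeff n i hi, mul_zero]

/-- Prepending a zero coordinate. -/
def consZero (n : ℕ) : (Fin n → ℤ) →ₗ[ℤ] (Fin (n + 1) → ℤ) where
  toFun v := Fin.cons 0 v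
  map_add' v w := by ext i; cases i using Fin.cases <;> simp
  map_smul' c v := by ext i; cases i using Fin.cases <;> simp

@[simp]
lemma consZero_apply (n : ℕ) (v : Fin n → ℤ) : consZero n v = Fin.cons 0 v := rfl

lemma topCoeff_map_consZero (n : ℕ) (x : ExteriorAlgebra ℤ (Fin n → ℤ)) :
    topCoeff (n + 1) (map (consZero n) x) = 0 := by
  suffices h : topCoeff (n + 1) ∘ₗ (map (consZero n)).toLinearMap = 0 from
    LinearMap.congr_fun h x
  refine linearMap_ext fun i w => ?_
  simp only [LinearMap.comp_apply, AlgHom.toLinearMap_apply, map_apply_ιMulti,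
    LinearMap.zero_apply]
  rcases eq_or_ne i (n + 1) with rfl | hi
  · rw [topCoeff_ιMulti]
    exact Matrix.det_eq_zero_of_column_eq_zero 0 fun j => by simp
  · exact isHomogeneousFunctional_topCoeff _ i hi _

lemma topCoeff_ι_mul_map_consZero (n : ℕ) (x : ExteriorAlgebra ℤ (Fin n → ℤ)) :
    topCoeff (n + 1) (ι ℤ (Fin.cons 1 0) * map (consZero n) x) = topCoeff n x := by
  suffices h : topCoeff (n + 1) ∘ₗ LinearMap.mulLeft ℤ (ι ℤ (Fin.cons 1 0)) ∘ₗ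
      (map (consZero n)).toLinearMap = topCoeff n from LinearMap.congr_fun h x
  refine linearMap_ext fun i w => ?_
  simp only [LinearMap.comp_apply, AlgHom.toLinearMap_apply, map_apply_ιMulti,
    LinearMap.mulLeft_apply, ι_mul_ιMulti]
  rcases eq_or_ne i n with rfl | hi
  · rw [topCoeff_ιMulti, topCoeff_ιMulti, Matrix.det_succ_row_zero, Fin.sum_univ_succ]
    simp only [Matrix.of_apply, Fin.cons_zero, Fin.cons_succ, Pi.zero_apply, mul_zero, zero_mul,
      Finset.sum_const_zero, add_zero, Fin.val_zero, pow_zero, one_mul]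
    rfl
  · rw [isHomogeneousFunctional_topCoeff n i hi, isHomogeneousFunctional_topCoeff _ _ (by omega)]

lemma ExteriorAlgebra.IsHomogeneousFunctional.comp_ι_mul {n d : ℕ}
    {X : ExteriorAlgebra ℤ (Fin n → ℤ) →ₗ[ℤ] ℤ} (h : IsHomogeneousFunctional (d + 1) X)
    (a : Fin n → ℤ) : IsHomogeneousFunctional d (X ∘ₗ LinearMap.mulLeft ℤ (ι ℤ a)) := by
  intro i hi w
  simp only [LinearMap.comp_apply, LinearMap.mulLeft_apply, ι_mul_ιMulti]
  exact h _ (by omega) _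

lemma ExteriorAlgebra.IsHomogeneousFunctional.comp_ι_mul_eq_zero {n : ℕ}
    {X : ExteriorAlgebra ℤ (Fin n → ℤ) →ₗ[ℤ] ℤ} (h : IsHomogeneousFunctional 0 X)
    (a : Fin n → ℤ) : X ∘ₗ LinearMap.mulLeft ℤ (ι ℤ a) = 0 := by
  refine linearMap_ext fun i w => ?_
  simp only [LinearMap.comp_apply, LinearMap.mulLeft_apply, ι_mul_ιMulti, LinearMap.zero_apply]
  exact h _ (by omega) _

/-- The sum of `c ^ |s| * X (∏ i ∈ s, v i) ^ 2` over the subsets `s` of `{k, …, k + m - 1}`,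
with the wedge products taken in increasing order. -/
noncomputable def sqSum {n : ℕ} (c : ℤ) (v : ℕ → Fin n → ℤ) :
    ℕ → ℕ → (ExteriorAlgebra ℤ (Fin n → ℤ) →ₗ[ℤ] ℤ) → ℤ
  | 0, _, X => X 1 ^ 2
  | m + 1, k, X =>
    sqSum c v m (k + 1) X + c * sqSum c v m (k + 1) (X ∘ₗ LinearMap.mulLeft ℤ (ι ℤ (v k)))

section sqSum

variable {n : ℕ} (c : ℤ) (v w : ℕ → Fin n → ℤ)

lemma sqSum_smul (a : ℤ) (m k : ℕ) (X : ExteriorAlgebra ℤ (Fin n → ℤ) →ₗ[ℤ] ℤ) :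
    sqSum c v m k (a • X) = a ^ 2 * sqSum c v m k X := by
  induction m generalizing k X with
  | zero => simp [sqSum, mul_pow]
  | succ m ih =>
    simp only [sqSum, LinearMap.smul_comp, ih]
    ring

lemma sqSum_zero (m k : ℕ) : sqSum c v m k 0 = 0 := by
  simpa using sqSum_smul c v 0 m k 0

lemma sqSum_parallelogram (m k : ℕ) (X Y : ExteriorAlgebra ℤ (Fin n → ℤ) →ₗ[ℤ] ℤ) :
    sqSum c v m k (X - Y) + sqSum c v m k (X + Y) =
      2 * (sqSum c v m k X + sqSum c v m k Y) := by
  induction m generalizing k X Y with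
  | zero =>
    simp only [sqSum, LinearMap.sub_apply, LinearMap.add_apply]
    ring
  | succ m ih =>
    simp only [sqSum, LinearMap.sub_comp, LinearMap.add_comp]
    linear_combination ih (k + 1) X Y + c * ih (k + 1) (X ∘ₗ LinearMap.mulLeft ℤ (ι ℤ (v k)))
      (Y ∘ₗ LinearMap.mulLeft ℤ (ι ℤ (v k)))

lemma sqSum_of_isHomogeneousFunctional {d : ℕ} (m k : ℕ)
    {X : ExteriorAlgebra ℤ (Fin n → ℤ) →ₗ[ℤ] ℤ} (h : IsHomogeneousFunctional d X) :
    sqSum c v m k X = c ^ d * sqSum 1 v m k X := by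
  induction m generalizing k X d with
  | zero =>
    cases d with
    | zero => simp [sqSum]
    | succ d =>
      have : X 1 = 0 := by simpa using h 0 (by omega) 0
      simp [sqSum, this]
  | succ m ih =>
    simp only [sqSum, ih (k + 1) h]
    cases d with
    | zero => simp [h.comp_ι_mul_eq_zero, sqSum_zero]
    | succ d =>
      rw [ih (k + 1) (h.comp_ι_mul _)]
      ring

lemma sqSum_map {l : ℕ} (f : (Fin n → ℤ) →ₗ[ℤ] (Fin l → ℤ)) (m k : ℕ)
    (X : ExteriorAlgebra ℤ (Fin l → ℤ) →ₗ[ℤ] ℤ) :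
    sqSum c (fun i => f (v i)) m k X = sqSum c v m k (X ∘ₗ (map f).toLinearMap) := by
  induction m generalizing k X with
  | zero => simp [sqSum]
  | succ m ih =>
    simp only [sqSum, ih]
    congr 3
    exact LinearMap.ext fun x => by simp

lemma sqSum_succ_start (m k : ℕ) (X : ExteriorAlgebra ℤ (Fin n → ℤ) →ₗ[ℤ] ℤ) :
    sqSum c v m (k + 1) X = sqSum c (fun i => v (i + 1)) m k X := by
  induction m generalizing k X with
  | zero => rfl
  | succ m ih => simp only [sqSum, ih]

lemma sqSum_of_last_eq_zero (m k : ℕ) (X : ExteriorAlgebra ℤ (Fin n → ℤ) →ₗ[ℤ] ℤ)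
    (h : v (k + m) = 0) : sqSum c v (m + 1) k X = sqSum c v m k X := by
  induction m generalizing k X with
  | zero =>
    rw [add_zero] at h
    simp [sqSum, h]
  | succ m ih =>
    have h' := fun X => ih (k + 1) X (by rw [← h]; congr 1; omega)
    rw [sqSum, h', h']
    rfl

variable {v w} in
/-- Rotating consecutive pairs of vectors by the matrix `!![1, -1; 1, 1]` changes the weight
from `1` to `2`. -/
lemma sqSum_rotate (h₀ : ∀ i, w (2 * i) = v (2 * i) - v (2 * i + 1))
    (h₁ : ∀ i, w (2 * i + 1) = v (2 * i) + v (2 * i + 1)) (m k : ℕ)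
    (X : ExteriorAlgebra ℤ (Fin n → ℤ) →ₗ[ℤ] ℤ) :
    sqSum 1 w (2 * m) (2 * k) X = sqSum 2 v (2 * m) (2 * k) X := by
  induction m generalizing k X with
  | zero => rfl
  | succ m ih =>
    have hk : 2 * k + 1 + 1 = 2 * (k + 1) := by ring
    have h2 : 2 * (m + 1) = 2 * m + 1 + 1 := by ring
    simp only [h2, sqSum, hk, ih, h₀, h₁]
    generalize v (2 * k) = a
    generalize v (2 * k + 1) = b
    have e₀ : X ∘ₗ LinearMap.mulLeft ℤ (ι ℤ (a - b)) =
        X ∘ₗ LinearMap.mulLeft ℤ (ι ℤ a) - X ∘ₗ LinearMap.mulLeft ℤ (ι ℤ b) := by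
      exact LinearMap.ext fun x => by simp [sub_mul]
    have e₁ : X ∘ₗ LinearMap.mulLeft ℤ (ι ℤ (a + b)) =
        X ∘ₗ LinearMap.mulLeft ℤ (ι ℤ a) + X ∘ₗ LinearMap.mulLeft ℤ (ι ℤ b) := by
      exact LinearMap.ext fun x => by simp [add_mul]
    have e₂ : (X ∘ₗ LinearMap.mulLeft ℤ (ι ℤ (a - b))) ∘ₗ LinearMap.mulLeft ℤ (ι ℤ (a + b)) =
        (2 : ℤ) • ((X ∘ₗ LinearMap.mulLeft ℤ (ι ℤ a)) ∘ₗ LinearMap.mulLeft ℤ (ι ℤ b)) := by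
      refine LinearMap.ext fun x => ?_
      have hab : ι ℤ (a - b) * (ι ℤ (a + b) * x) = (2 : ℤ) • (ι ℤ a * (ι ℤ b * x)) := by
        have hba : ι ℤ b * ι ℤ a = -(ι ℤ a * ι ℤ b) :=
          eq_neg_of_add_eq_zero_right (ι_add_mul_swap a b)
        simp only [map_sub, map_add, ← mul_assoc, sub_mul, mul_add, ι_sq_zero, hba]
        rw [← smul_mul_assoc]
        congr 1
        abel
      exact (congrArg X hab).trans (map_smul X 2 _)
    rw [e₂, e₀, e₁, sqSum_smul]
    linear_combination sqSum_parallelogram 2 v (2 * m) (2 * (k + 1))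
      (X ∘ₗ LinearMap.mulLeft ℤ (ι ℤ a)) (X ∘ₗ LinearMap.mulLeft ℤ (ι ℤ b))

end sqSum

/-- The ordered product of the `v i` over the positions `i` occupied in a word whose letters are
numbered from `k`: an even position is occupied by the letter `true`, an odd one by `false`. -/
noncomputable def wordProd {n : ℕ} (v : ℕ → Fin n → ℤ) :
    ℕ → List Bool → ExteriorAlgebra ℤ (Fin n → ℤ)
  | _, [] => 1
  | k, x :: s => (if x = decide (Even k) then ι ℤ (v k) else 1) * wordProd v (k + 1) s

section wordProd

variable {n : ℕ} {v w : ℕ → Fin n → ℤ}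

lemma sum_sq_wordProd (m k : ℕ) (X : ExteriorAlgebra ℤ (Fin n → ℤ) →ₗ[ℤ] ℤ) :
    ∑ ε : Fin m → Bool, X (wordProd v k (List.ofFn ε)) ^ 2 = sqSum 1 v m k X := by
  induction m generalizing k X with
  | zero => simp [sqSum, wordProd]
  | succ m ih =>
    rw [← (Fin.consEquiv fun _ => Bool).sum_comp, Fintype.sum_prod_type]
    simp only [sqSum, ← ih, Fin.consEquiv_apply, List.ofFn_succ, Fin.cons_zero, Fin.cons_succ,
      wordProd, Fintype.sum_bool]
    by_cases hk : Even k <;> simp [hk, add_comm]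

lemma wordProd_congr (k : ℕ) (s : List Bool)
    (h : ∀ i, k ≤ i → i < k + s.length → v i = w i) : wordProd v k s = wordProd w k s := by
  induction s generalizing k with
  | nil => rfl
  | cons x s ih =>
    rw [List.length_cons] at h
    rw [wordProd, wordProd, h k le_rfl (by omega),
      ih (k + 1) fun i hi hi' => h i (by omega) (by omega)]

lemma wordProd_append (k : ℕ) (s t : List Bool) :
    wordProd v k (s ++ t) = wordProd v k s * wordProd v (k + s.length) t := by
  induction s generalizing k with
  | nil => simp [wordProd]
  | cons x s ih => simp [wordProd, ih, mul_assoc, add_assoc, add_comm 1]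

lemma wordProd_map {l : ℕ} (f : (Fin n → ℤ) →ₗ[ℤ] (Fin l → ℤ)) (k : ℕ) (s : List Bool) :
    wordProd (fun i => f (v i)) k s = map f (wordProd v k s) := by
  induction s generalizing k with
  | nil => simp [wordProd]
  | cons x s ih => simp only [wordProd, ih, map_mul]; congr 1; split_ifs <;> simp

lemma wordProd_complement (k : ℕ) (s : List Bool) :
    wordProd v k (s.map fun b => !b) = wordProd (fun i => v (i - 1)) (k + 1) s := by
  induction s generalizing k with
  | nil => rfl
  | cons x s ih =>
    simp only [wordProd, List.map_cons, ih, Nat.add_sub_cancel]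
    by_cases hk : Even k <;> cases x <;> simp [hk, Nat.even_add_one]

/-- The hop of a particle across the edge `{a, a + 1}`, from its odd to its even end. -/
def hopAt (a : ℕ) (v : ℕ → Fin n → ℤ) : ℕ → Fin n → ℤ :=
  if Even a then Function.update v (a + 1) (v (a + 1) + v a)
  else Function.update v a (v a + v (a + 1))

lemma wordProd_hopAt (k j : ℕ) (s : List Bool) (hj : j + 1 < s.length) :
    wordProd (hopAt (k + j) v) k s = wordProd v k s +
      if s.getD j true = false ∧ s.getD (j + 1) true = false then
        wordProd v k ((s.set j true).set (j + 1) true) else 0 := by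
  induction j generalizing k s with
  | zero =>
    match s, hj with
    | x :: y :: t, _ =>
      have ht : wordProd (hopAt k v) (k + 1 + 1) t = wordProd v (k + 1 + 1) t := by
        refine wordProd_congr _ _ fun i hi _ => ?_
        unfold hopAt
        split_ifs <;> exact Function.update_of_ne (by omega) _ _
      have hsq (b : Fin n → ℤ) : ι ℤ b * (ι ℤ b * wordProd v (k + 1 + 1) t) = 0 := by
        rw [← mul_assoc, ι_sq_zero, zero_mul]
      simp only [add_zero, wordProd, ht]
      by_cases hk : Even k <;> cases x <;> cases y <;>
        simp [wordProd, hopAt, hk, Nat.even_add_one, add_mul, mul_add, hsq]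
  | succ j ih =>
    match s, hj with
    | x :: t, hj =>
      have hk : hopAt (k + (j + 1)) v k = v k := by
        unfold hopAt
        split_ifs <;> exact Function.update_of_ne (by omega) _ _
      have := ih (k + 1) t (by simpa using hj)
      rw [show k + 1 + j = k + (j + 1) by ring] at this
      simp only [wordProd, hk, this, mul_add, List.getD_cons_succ, List.set_cons_succ, mul_ite,
        mul_zero]

end wordProd

/-- Shift a sequence to the right, filling in a zero. -/
def shiftRight {M : Type*} [Zero M] (f : ℕ → M) : ℕ → M
  | 0 => 0
  | j + 1 => f j

/-- The effect on the vectors of all hops from an odd position to its neighbours. -/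
def hopAll {M : Type*} [Add M] (v : ℕ → M) (j : ℕ) : M :=
  if Even j then v j else v (j - 1) + v j + v (j + 1)

/-- The transfer operator of the recursion defining `C_n`. -/
def transfer : Module.End ℤ (ℕ → ℤ) where
  toFun f := hopAll (shiftRight f)
  map_add' f g := by
    ext j
    rcases j with _ | _ | j <;> simp only [hopAll, shiftRight, Pi.add_apply] <;> split_ifs <;>
      simp <;> ring
  map_smul' c f := by
    ext j
    rcases j with _ | _ | j <;> simp only [hopAll, shiftRight, Pi.smul_apply] <;> split_ifs <;>
      simp <;> ring

/-- The transfer operator minus the identity: a shift followed by a rotation, by the matrix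
`!![1, -1; 1, 1]`, of the pairs of positions `2 * i, 2 * i + 1`. -/
def rotor : Module.End ℤ (ℕ → ℤ) := transfer - 1

lemma rotor_even (f : ℕ → ℤ) (i : ℕ) :
    rotor f (2 * i) = shiftRight f (2 * i) - shiftRight f (2 * i + 1) := by
  simp [rotor, transfer, hopAll, shiftRight]

lemma rotor_odd (f : ℕ → ℤ) (i : ℕ) :
    rotor f (2 * i + 1) = shiftRight f (2 * i) + shiftRight f (2 * i + 1) := by
  simp [rotor, transfer, hopAll, shiftRight]

/-- The initial row, with ones in positions `0` and `1`. -/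
def initialRow (j : ℕ) : ℤ := if j < 2 then 1 else 0

lemma rotor_pow_initialRow_eq_zero (k j : ℕ) (h : 2 * k + 2 ≤ j) :
    (rotor ^ k) initialRow j = 0 := by
  induction k generalizing j with
  | zero => simp [initialRow]; omega
  | succ k ih =>
    obtain ⟨j, rfl⟩ := Nat.exists_eq_add_of_le' (show 2 ≤ j by omega)
    rw [pow_succ', Module.End.mul_apply]
    obtain ⟨i, rfl | rfl⟩ := Nat.even_or_odd' j
    · rw [show 2 * i + 2 = 2 * (i + 1) by ring, rotor_even]
      simp [mul_add, shiftRight, ih (2 * i + 1) (by omega), ih (2 * i + 2) (by omega)]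
    · rw [show 2 * i + 1 + 2 = 2 * (i + 1) + 1 by ring, rotor_odd]
      simp [mul_add, shiftRight, ih (2 * i + 1) (by omega), ih (2 * i + 2) (by omega)]

/-- The `j`-th column of the matrix with rows `A ^ k initialRow`, `k < n`. -/
def orbitColumn (A : Module.End ℤ (ℕ → ℤ)) (n j : ℕ) : Fin n → ℤ :=
  fun k => (A ^ (k : ℕ)) initialRow j

lemma orbitColumn_rotor_eq_zero {n j : ℕ} (h : 2 * n ≤ j) : orbitColumn rotor n j = 0 :=
  funext fun k => rotor_pow_initialRow_eq_zero k j (by omega)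

lemma orbitColumn_succ (A : Module.End ℤ (ℕ → ℤ)) (n j : ℕ) :
    orbitColumn A (n + 1) j =
      Fin.cons (initialRow j) fun k : Fin n => A ((A ^ (k : ℕ)) initialRow) j := by
  ext k
  cases k using Fin.cases <;> simp [orbitColumn, pow_succ']

lemma shiftRight_orbitColumn (A : Module.End ℤ (ℕ → ℤ)) (n j : ℕ) (k : Fin n) :
    shiftRight (orbitColumn A n) j k = shiftRight ((A ^ (k : ℕ)) initialRow) j := by
  cases j <;> rfl

lemma orbitColumn_transfer_succ (n j : ℕ) :
    orbitColumn transfer (n + 1) j =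
      Fin.cons (initialRow j) (hopAll (shiftRight (orbitColumn transfer n)) j) := by
  rw [orbitColumn_succ]
  congr 1
  ext k
  change hopAll _ _ = _
  unfold hopAll
  split_ifs <;> simp [shiftRight_orbitColumn]

lemma orbitColumn_transfer_eq (n j : ℕ) :
    orbitColumn transfer n j =
      (Matrix.of fun k l : Fin n => ((k : ℕ).choose l : ℤ)).toLin' (orbitColumn rotor n j) := by
  ext k
  have h : transfer = rotor + 1 := by simp [rotor]
  simp only [orbitColumn, Matrix.toLin'_apply, Matrix.mulVec, dotProduct, Matrix.of_apply]
  rw [h, (Commute.one_right rotor).add_pow, LinearMap.sum_apply, Finset.sum_apply,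
    Fin.sum_univ_eq_sum_range (fun l => ((k : ℕ).choose l : ℤ) * (rotor ^ l) initialRow j) n]
  simp only [one_pow, mul_one, ← nsmul_eq_mul', LinearMap.smul_apply, Pi.smul_apply]
  simp only [nsmul_eq_mul]
  refine Finset.sum_subset (Finset.range_mono k.isLt) fun l _ hl => ?_
  rw [Nat.choose_eq_zero_of_lt (by simpa using hl), Nat.cast_zero, zero_mul]

lemma orbitColumn_transfer_eq_zero {n j : ℕ} (h : 2 * n ≤ j) : orbitColumn transfer n j = 0 := by
  rw [orbitColumn_transfer_eq, orbitColumn_rotor_eq_zero h, map_zero]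

lemma det_choose (n : ℕ) : (Matrix.of fun k l : Fin n => ((k : ℕ).choose l : ℤ)).det = 1 := by
  rw [Matrix.det_of_isLowerTriangular]
  · simp
  · intro i j hij
    exact congrArg Nat.cast (Nat.choose_eq_zero_of_lt (OrderDual.toDual_lt_toDual.mp hij))

lemma topCoeff_wordProd_transfer (n k : ℕ) (s : List Bool) :
    topCoeff n (wordProd (orbitColumn transfer n) k s) =
      topCoeff n (wordProd (orbitColumn rotor n) k s) := by
  rw [funext (orbitColumn_transfer_eq n), wordProd_map, topCoeff_map, det_choose, one_mul]

lemma sqSum_orbitColumn_rotor_succ (n : ℕ) :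
    sqSum 1 (orbitColumn rotor (n + 1)) (2 * (n + 1)) 0 (topCoeff (n + 1)) =
      2 ^ (n + 1) * sqSum 1 (orbitColumn rotor n) (2 * n) 0 (topCoeff n) := by
  let v : ℕ → Fin (n + 1) → ℤ := fun j =>
    Fin.cons (if j = 0 then 1 else 0) (shiftRight (orbitColumn rotor n) j)
  have h₀ (i : ℕ) : orbitColumn rotor (n + 1) (2 * i) = v (2 * i) - v (2 * i + 1) := by
    rw [orbitColumn_succ]
    ext k
    cases k using Fin.cases with
    | zero => simp [v, initialRow, show 2 * i < 2 ↔ i = 0 by omega]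
    | succ k => simp [v, rotor_even, shiftRight_orbitColumn]
  have h₁ (i : ℕ) : orbitColumn rotor (n + 1) (2 * i + 1) = v (2 * i) + v (2 * i + 1) := by
    rw [orbitColumn_succ]
    ext k
    cases k using Fin.cases with
    | zero => simp [v, initialRow]
    | succ k => simp [v, rotor_odd, shiftRight_orbitColumn]
  have hlast : v (0 + (2 * n + 1)) = 0 := by
    ext k
    cases k using Fin.cases with
    | zero => simp [v]
    | succ k =>
      simp only [v, zero_add, Fin.cons_succ, shiftRight]
      exact congrFun (orbitColumn_rotor_eq_zero le_rfl) k
  have hv : (fun i => v (i + 1)) = fun i => consZero n (orbitColumn rotor n i) := by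
    ext1 i
    simp [v, shiftRight]
  have hv0 : v 0 = Fin.cons 1 0 := rfl
  have htop : topCoeff (n + 1) ∘ₗ (map (consZero n)).toLinearMap = 0 :=
    LinearMap.ext (topCoeff_map_consZero n)
  have htop' : (topCoeff (n + 1) ∘ₗ LinearMap.mulLeft ℤ (ι ℤ (v 0))) ∘ₗ
      (map (consZero n)).toLinearMap = topCoeff n :=
    LinearMap.ext (topCoeff_ι_mul_map_consZero n)
  rw [show (0 : ℕ) = 2 * 0 from rfl, sqSum_rotate h₀ h₁,
    sqSum_of_isHomogeneousFunctional 2 v _ _ (isHomogeneousFunctional_topCoeff _),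
    show 2 * (n + 1) = 2 * n + 1 + 1 by ring, mul_zero, sqSum_of_last_eq_zero 1 v _ _ _ hlast,
    sqSum, sqSum_succ_start, sqSum_succ_start, hv, sqSum_map, sqSum_map, htop, htop', sqSum_zero,
    zero_add, one_mul]

@[simp]
lemma extendZ_single (f : List Bool → (List Bool →₀ ℤ)) (l : List Bool) :
    extendZ f (Finsupp.single l 1) = f l := by
  simp [extendZ]

lemma C1fun_eq (a b : Bool) :
    C1fun [a, b] = topCoeff 1 (wordProd (orbitColumn transfer 1) 0 [a, b]) := by
  have h (i : ℕ) (hi : i < 2) : ι ℤ (orbitColumn transfer 1 i) = ιMulti ℤ 1 1 := by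
    rw [ιMulti_apply]
    simp only [List.ofFn_succ, List.ofFn_zero, List.prod_cons, List.prod_nil, mul_one]
    congr 1
    ext k
    simp [orbitColumn, initialRow, hi]
  have h₁ : topCoeff 1 (ιMulti ℤ 1 1) = 1 := by rw [topCoeff_ιMulti]; simp
  have h₀ : topCoeff 1 1 = 0 := by
    simpa using isHomogeneousFunctional_topCoeff 1 0 (by omega) 0
  have hsq : ιMulti ℤ 1 (1 : Fin 1 → Fin 1 → ℤ) * ιMulti ℤ 1 1 = 0 := by
    rw [← h 0 (by omega), ι_sq_zero]
  generalize ιMulti ℤ 1 (1 : Fin 1 → Fin 1 → ℤ) = x at *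
  cases a <;> cases b <;> simp [C1fun, wordProd, h, h₀, h₁, hsq]

/-- The effect on the vectors of the hops across the edges `{k + i, k + i + 1}`, `i < j`. -/
def hopTo {n : ℕ} (k : ℕ) : ℕ → (ℕ → Fin n → ℤ) → ℕ → Fin n → ℤ
  | 0, v => v
  | j + 1, v => hopTo k j (hopAt (k + j) v)

lemma apply_EhomAux_single {n : ℕ} {Φ : (List Bool →₀ ℤ) →+ ℤ}
    {X : ExteriorAlgebra ℤ (Fin n → ℤ) →ₗ[ℤ] ℤ} {v : ℕ → Fin n → ℤ} {m k : ℕ}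
    (h : ∀ s : List Bool, s.length = m → Φ (Finsupp.single s 1) = X (wordProd v k s))
    (j : ℕ) (hj : j < m) (s : List Bool) (hs : s.length = m) :
    Φ (EhomAux j (Finsupp.single s 1)) = X (wordProd (hopTo k j v) k s) := by
  induction j generalizing Φ v with
  | zero => exact h s hs
  | succ j ih =>
    refine ih (Φ := Φ.comp (extendZ (basicExp j))) (fun s hs => ?_) (by omega)
    rw [wordProd_hopAt k j s (by omega), AddMonoidHom.comp_apply, extendZ_single, basicExp]
    split_ifs
    · rw [map_add, map_add, h s hs, h _ (by simpa using hs)]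
    · rw [add_zero, h s hs]

lemma hopAt_apply {n : ℕ} (a : ℕ) (v : ℕ → Fin n → ℤ) (i : ℕ) :
    hopAt a v i = if Even i then v i else
      (if i = a + 1 then v (i - 1) else 0) + v i + if i = a then v (i + 1) else 0 := by
  unfold hopAt
  split_ifs <;> simp only [Function.update_apply] <;> split_ifs <;> grind

lemma hopTo_apply {n : ℕ} (j : ℕ) (v : ℕ → Fin n → ℤ) (i : ℕ) (hi : 1 ≤ i) :
    hopTo 1 j v i = if Even i then v i else
      (if 2 ≤ i ∧ i ≤ j + 1 then v (i - 1) else 0) + v i + if i ≤ j then v (i + 1) else 0 := by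
  induction j generalizing v with
  | zero =>
    simp only [hopTo]
    split_ifs with h₁ h₂ h₃ h₃ <;> first | omega | simp
  | succ j ih =>
    rw [hopTo, ih]
    by_cases h : Even i
    · simp [hopAt_apply, h]
    · have h₁ : Even (i - 1) := by grind
      have h₂ : Even (i + 1) := by grind
      simp only [hopAt_apply, h, h₁, h₂, if_true, if_false]
      grind

lemma hopTo_eq_hopAll {n : ℕ} {v : ℕ → Fin n → ℤ} (hv : v 0 = 0) (m i : ℕ) (hi : 1 ≤ i)
    (hi' : i ≤ 2 * m + 2) : hopTo 1 (2 * m + 1) v i = hopAll v i := by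
  rw [hopTo_apply _ _ _ hi, hopAll]
  split_ifs with h₁ h₂ h₃ h₃
  · rfl
  · rfl
  · grind
  · rw [show i = 1 by omega, hv]
  · grind

lemma Kfun_eq (a b c d : Bool) (s : List Bool) :
    Kfun (a :: b :: (s ++ [c, d])) = match contractFront a b, contractBack c d with
      | some x, some z => Finsupp.single (x :: (s ++ [z])) 1
      | _, _ => 0 := by
  have h : (a :: b :: (s ++ [c, d])).reverse = d :: c :: (s.reverse ++ [b, a]) := by simp
  simp only [Kfun, h]
  cases contractFront a b <;> cases contractBack c d <;> simp

lemma back_factor {n : ℕ} (u : Fin n → ℤ) (c d : Bool) :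
    (if c = true then ι ℤ u else 1) * (if d = false then ι ℤ u else 1) =
      match contractBack c d with
      | some z => if z = true then ι ℤ u else 1
      | none => 0 := by
  cases c <;> cases d <;> simp [contractBack]

lemma front_factor {n : ℕ} (u : Fin n → ℤ) (a b : Bool) (x : ExteriorAlgebra ℤ (Fin n → ℤ)) :
    topCoeff (n + 1) ((if a = true then ι ℤ (Fin.cons 1 0) else 1) *
        ((if b = false then ι ℤ (Fin.cons 1 u) else 1) * map (consZero n) x)) =
      match contractFront a b with
      | some y => topCoeff n ((if y = false then ι ℤ u else 1) * x)
      | none => 0 := by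
  have hu : ι ℤ (Fin.cons 1 u : Fin (n + 1) → ℤ) =
      ι ℤ (Fin.cons 1 0) + map (consZero n) (ι ℤ u) := by
    rw [map_apply_ι, ← map_add]
    congr 1
    ext i
    cases i using Fin.cases <;> simp
  have hsq :
      ι ℤ (Fin.cons 1 0 : Fin (n + 1) → ℤ) * (ι ℤ (Fin.cons 1 0) * map (consZero n) x) = 0 := by
    rw [← mul_assoc, ι_sq_zero, zero_mul]
  rw [hu]
  cases a <;> cases b <;>
    simp only [contractFront, if_true, if_false, one_mul, add_mul, mul_add, hsq, zero_add, map_add,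
      ← map_mul, topCoeff_map_consZero, topCoeff_ι_mul_map_consZero, add_zero, Bool.false_eq_true,
      Bool.true_eq_false]

lemma exists_eq_cons_cons_append {α : Type*} {m : ℕ} (l : List α) (h : l.length = m + 4) :
    ∃ a b c d s, s.length = m ∧ l = a :: b :: (s ++ [c, d]) := by
  match l, h with
  | a :: b :: t, h =>
    have ht : t.length = m + 2 := by simpa using h
    obtain ⟨c, d, hcd⟩ := List.length_eq_two.mp (show (t.drop m).length = 2 by simp [ht])
    exact ⟨a, b, c, d, t.take m, by simp [ht], by rw [← hcd, List.take_append_drop]⟩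

/-- The values of `C_n` are, up to the encoding of words by sets of occupied positions, the
maximal minors of the matrix with rows `transfer ^ k initialRow`. -/
lemma Chom_single (n : ℕ) (l : List Bool) (hl : l.length = 2 * (n + 1)) :
    Chom (n + 1) (Finsupp.single l 1) =
      topCoeff (n + 1) (wordProd (orbitColumn transfer (n + 1)) 0 l) := by
  induction n generalizing l with
  | zero =>
    obtain ⟨a, b, rfl⟩ := List.length_eq_two.mp hl
    rw [← C1fun_eq]
    simp [Chom, liftZ]
  | succ n ih =>
    obtain ⟨a, b, c, d, s, hs, rfl⟩ := exists_eq_cons_cons_append (m := 2 * n) l (by omega)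
    set v := shiftRight (orbitColumn transfer (n + 1)) with hv
    set u := hopAll v with hu
    have hR (t : List Bool) (ht : t.length = 2 * n + 2) :
        (Chom (n + 1)).comp Rhom (Finsupp.single t 1) = topCoeff (n + 1) (wordProd v 1 t) := by
      rw [AddMonoidHom.comp_apply, Rhom, extendZ_single, ih _ (by simpa [mul_add] using ht),
        wordProd_complement]
      congr 1
      refine wordProd_congr _ _ fun i hi _ => ?_
      obtain ⟨i, rfl⟩ := Nat.exists_eq_add_of_le' hi
      rfl
    have hE (t : List Bool) (ht : t.length = 2 * n + 2) :
        (((Chom (n + 1)).comp Rhom).comp (EhomAux (2 * n + 1))) (Finsupp.single t 1) =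
          topCoeff (n + 1) (wordProd u 1 t) := by
      rw [AddMonoidHom.comp_apply, apply_EhomAux_single hR _ (by omega) t ht]
      congr 1
      exact wordProd_congr _ _ fun i hi hi' => hopTo_eq_hopAll rfl n i hi (by omega)
    have hp (j : ℕ) : orbitColumn transfer (n + 1 + 1) j = Fin.cons (initialRow j) (u j) :=
      orbitColumn_transfer_succ (n + 1) j
    have hlast : u (2 * n + 3) = u (2 * n + 2) := by
      have h₂ : Even (2 * n + 2) := by grind
      have h₃ : ¬ Even (2 * n + 3) := by grind
      simp [hu, hopAll, hv, shiftRight, orbitColumn_transfer_eq_zero, h₂, h₃, mul_add]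
    have hp0 : orbitColumn transfer (n + 1 + 1) 0 = Fin.cons 1 0 := by
      rw [hp]; rfl
    have hp1 : orbitColumn transfer (n + 1 + 1) 1 = Fin.cons 1 (u 1) := by
      rw [hp]; rfl
    have hp2 (t : List Bool) : wordProd (orbitColumn transfer (n + 1 + 1)) 2 t =
        map (consZero (n + 1)) (wordProd u 2 t) := by
      rw [← wordProd_map]
      refine wordProd_congr _ _ fun i hi _ => ?_
      rw [hp, initialRow, if_neg (by omega)]
      rfl
    have hback : wordProd u 2 (s ++ [c, d]) = wordProd u 2 s *
        match contractBack c d with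
        | some z => if z = true then ι ℤ (u (2 * n + 2)) else 1
        | none => 0 := by
      rw [wordProd_append, ← back_factor, hs, add_comm 2]
      simp [wordProd, Nat.even_add_one, hlast]
    rw [Chom, AddMonoidHom.comp_apply, Khom, extendZ_single, Kfun_eq, wordProd, wordProd, hp0,
      zero_add, hp1, hp2]
    have hf := front_factor (u 1) a b (wordProd u 2 (s ++ [c, d]))
    simp only [Nat.not_even_one, decide_false, Even.zero, decide_true]
    rw [hf, hback]
    rcases contractFront a b with _ | x <;> rcases contractBack c d with _ | z <;>
      simp only [mul_zero, map_zero]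
    rw [hE _ (by simp [hs])]
    simp [wordProd, wordProd_append, hs, Nat.even_add_one, add_comm 2]

lemma sqSum_orbitColumn_rotor (n : ℕ) :
    sqSum 1 (orbitColumn rotor n) (2 * n) 0 (topCoeff n) = 2 ^ (n * (n + 1) / 2) := by
  induction n with
  | zero =>
    have h : topCoeff 0 1 = 1 := by
      rw [← ιMulti_zero_apply (R := ℤ) (0 : Fin 0 → Fin 0 → ℤ), topCoeff_ιMulti]
      simp
    simp [sqSum, h]
  | succ n ih =>
    rw [sqSum_orbitColumn_rotor_succ, ih, ← pow_add]
    congr 1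
    rw [show (n + 1) * (n + 1 + 1) = n * (n + 1) + (n + 1) * 2 by ring,
      Nat.add_mul_div_right _ _ two_pos, add_comm]

/-- The `l²` norm of `C_n` equals `2^{n(n+1)/2}`. -/
theorem l2_norm_C (n : ℕ) (hn : 1 ≤ n) :
    (∑ ε : Fin (2 * n) → Bool, (Cfun n ε) ^ 2) = 2 ^ (n * (n + 1) / 2) := by
  obtain ⟨n, rfl⟩ := Nat.exists_eq_add_of_le' hn
  rw [← sqSum_orbitColumn_rotor, ← sum_sq_wordProd]
  refine Finset.sum_congr rfl fun ε _ => ?_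
  rw [Cfun, Chom_single n _ List.length_ofFn, topCoeff_wordProd_transfer]
end
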